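/- arXiv:2106.14673 — 3 statements merged into one kernel-verified Lean document; each statement's English description precedes it below -/
import Mathlib

section
/- Let B be an Erdős set and let (X_η, S) be the associated B-free subshift. Then the Garden of Eden theorem holds: a cellular automaton τ on (X_η, S) is surjective if and only if it is pre-injective. -/
open Filter Set

noncomputable section

/-- The shift by `t`: `(shiftPow t x) n = x (n + t)`, i.e. `S^t`. -/
def shiftPow (t : ℤ) (x : ℤ → Bool) : ℤ → Bool := fun n => x (n + t)

/-- The left shift `S`, `(S x) n = x (n + 1)`. -/
def shift : (ℤ → Bool) → (ℤ → Bool) := shiftPow 1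

/-- The support of a `0-1`-sequence. -/
def supp (x : ℤ → Bool) : Set ℤ := {n | x n = true}

/-- The all-zero sequence `0^ℤ`. -/
def zeroSeq : ℤ → Bool := fun _ => false

/-- The all-one sequence `1^ℤ`. -/
def oneSeq : ℤ → Bool := fun _ => true

/-- The sequence `u = 0^{-ℕ} 1 0^{ℕ}` with a single `1` at position `0`. -/
def uSeq : ℤ → Bool := fun n => if n = 0 then true else false

/-- The set `F_B ⊆ ℤ` of `B`-free integers. -/
def BFreeSet (B : Set ℕ) : Set ℤ := {n | ∀ b ∈ B, ¬ ((b : ℤ) ∣ n)}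

open Classical in
/-- `η`, the indicator function of the `B`-free integers. -/
noncomputable def eta (B : Set ℕ) : ℤ → Bool := fun n => if n ∈ BFreeSet B then true else false

/-- The `B`-free subshift `X_η`: the orbit closure of `η` under the shift. -/
def Xeta (B : Set ℕ) : Set (ℤ → Bool) := closure {x | ∃ t : ℤ, x = shiftPow t (eta B)}

/-- A set `A ⊆ ℤ` is `B`-admissible if for every `b ∈ B` some residue class
mod `b` is disjoint from `A`. -/
def IsBAdmissible (B : Set ℕ) (A : Set ℤ) : Prop :=
  ∀ b ∈ B, ∃ r : ℤ, ∀ a ∈ A, ¬ ((b : ℤ) ∣ (a - r))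

/-- The `B`-admissible subshift `X_B`. -/
def XB (B : Set ℕ) : Set (ℤ → Bool) := {x | IsBAdmissible B (supp x)}

/-- `B` is primitive: no element divides a different element. -/
def Primitive (B : Set ℕ) : Prop := ∀ a ∈ B, ∀ b ∈ B, a ∣ b → a = b

/-- `B` is an Erdős set: infinite, `1 ∉ B` (elements positive), primitive, pairwise
coprime and thin. -/
def IsErdos (B : Set ℕ) : Prop :=
  B.Infinite ∧ (∀ b ∈ B, 2 ≤ b) ∧ Primitive B ∧
    (∀ a ∈ B, ∀ b ∈ B, a ≠ b → Nat.Coprime a b) ∧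
    Summable (fun b : B => (1 : ℝ) / (b : ℝ))

/-- A cellular automaton on `X`: a continuous self-map of `X` commuting with the shift. -/
def IsCA (X : Set (ℤ → Bool)) (τ : (ℤ → Bool) → (ℤ → Bool)) : Prop :=
  Set.MapsTo τ X X ∧ ContinuousOn τ X ∧ ∀ x ∈ X, τ (shift x) = shift (τ x)

/-- Pre-injectivity of a CA on `X`. -/
def PreInjective (X : Set (ℤ → Bool)) (τ : (ℤ → Bool) → (ℤ → Bool)) : Prop :=
  ∀ x ∈ X, ∀ y ∈ X, τ x = τ y → {n : ℤ | x n ≠ y n}.Finite → x = y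

/-- `X` is hereditary. -/
def Hereditary (X : Set (ℤ → Bool)) : Prop :=
  ∀ x ∈ X, ∀ y : ℤ → Bool, (∀ n, y n ≤ x n) → y ∈ X

/-- The hereditary closure `X̃` of a set `X`. -/
def heredClosure (X : Set (ℤ → Bool)) : Set (ℤ → Bool) :=
  {y | ∃ x ∈ X, ∀ n, y n ≤ x n}

/-- `X` is a subshift: nonempty, closed and shift-invariant. -/
def IsSubshift (X : Set (ℤ → Bool)) : Prop :=
  X.Nonempty ∧ IsClosed X ∧ shift '' X = X

/-- `τ` is given by a (sliding block) code of radius `ℓ` on `X`. -/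
def HasRadius (X : Set (ℤ → Bool)) (τ : (ℤ → Bool) → (ℤ → Bool)) (ℓ : ℕ) : Prop :=
  ∀ x ∈ X, ∀ y ∈ X, ∀ n : ℤ,
    (∀ i : ℤ, n - ℓ ≤ i → i ≤ n + ℓ → x i = y i) → τ x n = τ y n

open Classical in
/-- `A ⊆ ℤ` has logarithmic density `d`. -/
noncomputable def HasLogDensity (A : Set ℤ) (d : ℝ) : Prop :=
  Tendsto (fun N : ℕ =>
      (Real.log N)⁻¹ * ∑ n ∈ Finset.Icc 1 N, (if (n : ℤ) ∈ A then (1 : ℝ) / (n : ℝ) else 0))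
    atTop (nhds d)

/-- `B` is taut: removing any `b ∈ B` strictly increases the logarithmic density of the
`B`-free integers. -/
def IsTaut (B : Set ℕ) : Prop :=
  ∀ b ∈ B, ∀ d d' : ℝ,
    HasLogDensity (BFreeSet B) d → HasLogDensity (BFreeSet (B \ {b})) d' → d < d'

/-- `x` and `y` are proximal: along some sequence `r k → ∞`, the shifted sequences
`S^{r k} x` and `S^{r k} y` agree on arbitrarily large central windows, i.e.
`d(S^{r k} x, S^{r k} y) → 0` in the product topology. -/
def ProximalPair (x y : ℤ → Bool) : Prop :=
  ∃ r : ℕ → ℤ, Tendsto r atTop atTop ∧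
    ∀ m : ℕ, ∀ᶠ k in atTop, ∀ n : ℤ, |n| ≤ (m : ℤ) →
      shiftPow (r k) x n = shiftPow (r k) y n

/-- A subshift is proximal if every pair of its points is proximal. -/
def IsProximalSubshift (X : Set (ℤ → Bool)) : Prop :=
  ∀ x ∈ X, ∀ y ∈ X, ProximalPair x y

end


/-- The sequence with support `A`. -/
noncomputable def indSeq (A : Set ℤ) : ℤ → Bool := by
  classical exact fun n => decide (n ∈ A)

lemma indSeq_eq_true {A : Set ℤ} {n : ℤ} : indSeq A n = true ↔ n ∈ A := by
  simp [indSeq]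

lemma supp_indSeq (A : Set ℤ) : supp (indSeq A) = A := by
  ext n; exact indSeq_eq_true

lemma crt (Q : Finset ℕ) (h0 : ∀ b ∈ Q, b ≠ 0)
    (hc : ∀ a ∈ Q, ∀ b ∈ Q, a ≠ b → Nat.Coprime a b) (ρ : ℕ → ℤ) :
    ∃ t : ℤ, ∀ b ∈ Q, (b : ℤ) ∣ t - ρ b := by
  obtain ⟨k, hk⟩ := Nat.chineseRemainderOfFinset (fun b => (ρ b % b).toNat) (fun b => b) Q h0
    (fun a ha b hb hab => hc a ha b hb hab)
  refine ⟨k, fun b hb => ?_⟩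
  have h1 := (Nat.modEq_iff_dvd.1 (hk b hb))
  have hb0 : (b : ℤ) ≠ 0 := by exact_mod_cast h0 b hb
  rw [Int.toNat_of_nonneg (Int.emod_nonneg _ hb0)] at h1
  have h2 : (b : ℤ) ∣ ρ b - ρ b % b := Int.dvd_self_sub_emod
  have h3 : (k : ℤ) - ρ b = -((ρ b % b - k) + (ρ b - ρ b % b)) := by ring
  rw [h3]
  exact (dvd_add h1 h2).neg_right

/-- Positions with prescribed residues which are large and far apart. -/
lemma exists_sparse_positions {ι : Type*} [Finite ι] (Q : Finset ℕ) (h0 : ∀ b ∈ Q, b ≠ 0)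
    (hc : ∀ a ∈ Q, ∀ b ∈ Q, a ≠ b → Nat.Coprime a b) (ρ : ι → ℕ → ℤ) (L : ℕ) :
    ∃ p : ι → ℤ, (∀ i, ∀ b ∈ Q, (b : ℤ) ∣ p i - ρ i b) ∧ (∀ i, (L : ℤ) < p i) ∧
      ∀ i j, i ≠ j → (L : ℤ) < |p i - p j| := by
  choose t ht using fun i => crt Q h0 hc (ρ i)
  obtain ⟨n, ⟨e⟩⟩ := Finite.exists_equiv_fin ι
  set P : ℤ := ∏ b ∈ Q, (b : ℤ) with hP
  have hPpos : 0 < P := Finset.prod_pos fun b hb => by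
    have := h0 b hb; positivity
  have hr0 : ∀ i, 0 ≤ t i % P := fun i => Int.emod_nonneg _ hPpos.ne'
  have hr1 : ∀ i, t i % P < P := fun i => Int.emod_lt_of_pos _ hPpos
  refine ⟨fun i => t i % P + P * ((L + 2) * ((e i : ℕ) + 1)), fun i b hb => ?_, fun i => ?_, ?_⟩
  · have hbP : (b : ℤ) ∣ P := Finset.dvd_prod_of_mem _ hb
    have h1 : t i % P + P * ((L + 2) * ((e i : ℕ) + 1)) - ρ i b
        = (t i - ρ i b) - (t i - t i % P) + P * ((L + 2) * ((e i : ℕ) + 1)) := by ring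
    rw [h1]
    exact dvd_add (dvd_sub (ht i b hb) (hbP.trans Int.dvd_self_sub_emod)) (hbP.mul_right _)
  · have := hr0 i
    have : (0 : ℤ) ≤ (e i : ℕ) := by positivity
    nlinarith [mul_nonneg (sub_nonneg.2 (show (1 : ℤ) ≤ P from hPpos))
      (show (0 : ℤ) ≤ (L + 2) * ((e i : ℕ) + 1) by positivity)]
  · have key : ∀ i j, (e i : ℕ) < (e j : ℕ) → (L : ℤ) <
        (t j % P + P * ((L + 2) * ((e j : ℕ) + 1))) -
          (t i % P + P * ((L + 2) * ((e i : ℕ) + 1))) := by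
      intro i j hij
      have h1 := hr1 i
      have h2 := hr0 j
      have h3 : (1 : ℤ) ≤ (e j : ℕ) - (e i : ℕ) := by omega
      have h4 : P * (L + 2) * 1 ≤ P * (L + 2) * ((e j : ℕ) - (e i : ℕ)) :=
        mul_le_mul_of_nonneg_left h3 (by positivity)
      nlinarith [mul_nonneg (sub_nonneg.2 (show (1 : ℤ) ≤ P from hPpos))
        (show (0 : ℤ) ≤ (L : ℤ) + 1 by positivity)]
    intro i j hij
    have hne : (e i : ℕ) ≠ (e j : ℕ) := fun h => hij (e.injective (Fin.ext h))
    rcases lt_or_gt_of_ne hne with h | h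
    · rw [abs_sub_comm]; exact (key i j h).trans_le (le_abs_self _)
    · exact (key j i h).trans_le (le_abs_self _)

lemma exists_finset_tail {B : Set ℕ} (hB : IsErdos B) {ε : ℝ} (hε : 0 < ε) :
    ∃ s : Finset ℕ, (↑s : Set ℕ) ⊆ B ∧ ∀ F : Finset ℕ, (↑F : Set ℕ) ⊆ B → Disjoint F s →
      ∑ b ∈ F, (1 : ℝ) / b < ε := by
  classical
  obtain ⟨s, hs⟩ := summable_iff_vanishing_norm.1 hB.2.2.2.2 ε hε
  refine ⟨s.map (Function.Embedding.subtype _), by simp, fun F hF hd => ?_⟩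
  have h1 := hs (F.subtype (· ∈ B)) (by
    rw [Finset.disjoint_left] at hd ⊢
    intro a ha has
    exact hd (Finset.mem_subtype.1 ha) (Finset.mem_map.2 ⟨a, has, rfl⟩))
  have h2 : ∑ b ∈ F.subtype (· ∈ B), (1 : ℝ) / ((b : ℕ) : ℝ) = ∑ b ∈ F, (1 : ℝ) / b :=
    Finset.sum_subtype_of_mem (fun b : ℕ => (1 : ℝ) / b) hF
  rw [h2] at h1
  exact (le_abs_self _).trans_lt h1

lemma card_filter_dvd_le (M b : ℕ) (P c : ℤ) (hb : 0 < b) (hc : IsCoprime (b : ℤ) P) :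
    (((Finset.range M).filter fun m : ℕ => (b : ℤ) ∣ c + m * P).card : ℝ) ≤ M / b + 1 := by
  rcases Finset.eq_empty_or_nonempty
    ((Finset.range M).filter fun m : ℕ => (b : ℤ) ∣ c + m * P) with h | ⟨m₀, hm₀⟩
  · rw [h]; simp; positivity
  · have hsub : ((Finset.range M).filter fun m : ℕ => (b : ℤ) ∣ c + m * P) ⊆
        (Finset.range M).filter fun m : ℕ => m ≡ m₀ [MOD b] := by
      intro m hm
      simp only [Finset.mem_filter] at hm hm₀ ⊢
      refine ⟨hm.1, Nat.modEq_iff_dvd.2 (hc.dvd_of_dvd_mul_right ?_)⟩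
      have := dvd_sub hm₀.2 hm.2
      convert this using 1; ring
    have h1 := Finset.card_le_card hsub
    rw [← Nat.count_eq_card_filter_range (· ≡ m₀ [MOD b]), Nat.count_modEq_card _ hb] at h1
    have h2 : M / b + (if m₀ % b < M % b then 1 else 0) ≤ M / b + 1 := by split_ifs <;> simp
    calc _ ≤ ((M / b + 1 : ℕ) : ℝ) := by exact_mod_cast h1.trans h2
      _ ≤ _ := by push_cast; gcongr; exact Nat.cast_div_le

/-- A residue class modulo a product of elements of `B` contains a translate avoiding the
multiples of all the other elements, as soon as these have a small sum of reciprocals. -/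
lemma exists_avoiding {B : Set ℕ} (hB : IsErdos B) (A : Finset ℤ) (Q : Finset ℕ)
    (hQ : (↑Q : Set ℕ) ⊆ B)
    (hsum : ∀ F : Finset ℕ, (↑F : Set ℕ) ⊆ B → Disjoint F Q →
      ∑ b ∈ F, (1 : ℝ) / b < 1 / (4 * (A.card + 1))) (t₀ : ℤ) :
    ∃ t : ℤ, (∏ b ∈ Q, (b : ℤ)) ∣ t - t₀ ∧
      ∀ b ∈ B, b ∉ Q → ∀ a ∈ A, ¬ (b : ℤ) ∣ t + a := by
  classical
  have hBpos : ∀ b ∈ B, 0 < b := fun b hb => by have := hB.2.1 b hb; omega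
  set P : ℤ := ∏ b ∈ Q, (b : ℤ) with hP
  have hPpos : 0 < P := Finset.prod_pos fun b hb => by
    have := hBpos b (hQ hb); positivity
  have hcop : ∀ b ∈ B, b ∉ Q → IsCoprime (b : ℤ) P := fun b hb hbQ =>
    IsCoprime.prod_right fun q hq => Nat.isCoprime_iff_coprime.2
      (hB.2.2.2.1 b hb q (hQ hq) fun h => hbQ (h ▸ hq))
  obtain ⟨n, hn⟩ : ∃ n : ℕ, ∀ a ∈ A, |a| ≤ n := by
    refine ⟨∑ a ∈ A, a.natAbs, fun a ha => ?_⟩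
    rw [Int.abs_eq_natAbs]
    exact_mod_cast Finset.single_le_sum (f := fun a : ℤ => a.natAbs) (fun _ _ => Nat.zero_le _) ha
  obtain ⟨t₁, ht₁, hnt₁⟩ : ∃ t₁ : ℤ, P ∣ t₁ - t₀ ∧ (n : ℤ) < t₁ := by
    refine ⟨t₀ + P * (|t₀| + n + 1), ⟨|t₀| + n + 1, by ring⟩, ?_⟩
    have h1 := neg_abs_le t₀
    have h2 := abs_nonneg t₀
    nlinarith [mul_nonneg (sub_nonneg.2 (show (1 : ℤ) ≤ P from hPpos))
      (show (0 : ℤ) ≤ |t₀| + n + 1 by positivity)]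
  have hPR : (0 : ℝ) < P := by exact_mod_cast hPpos
  obtain ⟨s, hsB, hs⟩ := exists_finset_tail hB (ε := 1 / (4 * (A.card + 1) * P)) (by positivity)
  by_contra! hcon
  set k : ℝ := (A.card : ℝ) with hk
  have hk0 : 0 ≤ k := by positivity
  have main : ∀ M : ℕ, (M : ℝ) ≤ k * (M * (1 / (4 * (k + 1))) +
      (s.card + (t₁ + n + M * P) * (1 / (4 * (k + 1) * P)))) := by
    intro M
    set R : ℤ := t₁ + n + M * P with hR
    have hR0 : 0 ≤ R := by
      have : 0 ≤ t₁ := by omega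
      positivity
    set G : Finset ℕ := (Finset.Icc 1 R.toNat).filter fun b => b ∈ B ∧ b ∉ Q with hG
    have hGB : (↑G : Set ℕ) ⊆ B := fun b hb => by
      have : b ∈ G := hb
      simp only [hG, Finset.mem_filter] at this; exact this.2.1
    have hGQ : Disjoint G Q := Finset.disjoint_left.2 fun b hb => by
      simp only [hG, Finset.mem_filter] at hb; exact hb.2.2
    have hcover : Finset.range M ⊆ A.biUnion fun a => G.biUnion fun b =>
        (Finset.range M).filter fun m : ℕ => (b : ℤ) ∣ (t₁ + a) + m * P := by
      intro m hm
      obtain ⟨b, hb, hbQ, a, ha, hd⟩ := hcon (t₁ + m * P) (by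
        have : t₁ + m * P - t₀ = (t₁ - t₀) + m * P := by ring
        rw [this]; exact dvd_add ht₁ (dvd_mul_left _ _))
      have hd' : (b : ℤ) ∣ (t₁ + a) + m * P := by convert hd using 1; ring
      simp only [Finset.mem_biUnion, Finset.mem_filter, hG, Finset.mem_Icc]
      refine ⟨a, ha, b, ⟨⟨hBpos b hb, ?_⟩, hb, hbQ⟩, hm, hd'⟩
      have ha' := abs_le.1 (hn a ha)
      have hmM : (m : ℤ) ≤ M := by exact_mod_cast (Finset.mem_range.1 hm).le
      have hmP : (m : ℤ) * P ≤ M * P := by gcongr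
      have hmP0 : 0 ≤ (m : ℤ) * P := by positivity
      have := Int.le_of_dvd (by linarith) hd'
      omega
    have h1 : (M : ℝ) ≤ ∑ a ∈ A, ∑ b ∈ G, ((M : ℝ) / b + 1) := by
      have := Finset.card_le_card hcover
      rw [Finset.card_range] at this
      calc (M : ℝ) ≤ ((∑ a ∈ A, ∑ b ∈ G,
            ((Finset.range M).filter fun m : ℕ => (b : ℤ) ∣ (t₁ + a) + m * P).card : ℕ) : ℝ) := by
            exact_mod_cast this.trans (Finset.card_biUnion_le.trans
              (Finset.sum_le_sum fun a _ => Finset.card_biUnion_le))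
        _ ≤ _ := by
            push_cast
            refine Finset.sum_le_sum fun a _ => Finset.sum_le_sum fun b hb => ?_
            simp only [hG, Finset.mem_filter] at hb
            exact card_filter_dvd_le M b P _ (hBpos b hb.2.1) (hcop b hb.2.1 hb.2.2)
    have h2 : ∑ b ∈ G, ((M : ℝ) / b + 1) = M * ∑ b ∈ G, (1 : ℝ) / b + G.card := by
      rw [Finset.sum_add_distrib, Finset.mul_sum]
      simp [div_eq_mul_inv]
    have h3 : (G.card : ℝ) ≤ s.card + R * (1 / (4 * (k + 1) * P)) := by
      have h4 : (G.card : ℝ) ≤ s.card + (G \ s).card := by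
        rw [add_comm]
        exact_mod_cast Finset.card_le_card_sdiff_add_card (s := G) (t := s)
      have h5 := hs (G \ s) (fun b hb => hGB (Finset.sdiff_subset hb)) Finset.sdiff_disjoint
      have h6 : ((G \ s).card : ℝ) ≤ R * ∑ b ∈ G \ s, (1 : ℝ) / b := by
        rw [Finset.mul_sum, Finset.card_eq_sum_ones, Nat.cast_sum]
        refine Finset.sum_le_sum fun b hb => ?_
        have hb' := Finset.sdiff_subset hb
        simp only [hG, Finset.mem_filter, Finset.mem_Icc] at hb'
        have hbpos : (0 : ℝ) < b := by exact_mod_cast hb'.1.1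
        have hbR : (b : ℤ) ≤ R := by omega
        have hbR' : (b : ℝ) ≤ R := by exact_mod_cast hbR
        rw [mul_one_div, le_div_iff₀ hbpos]; simpa using hbR'
      have h7 : (0 : ℝ) ≤ R := by exact_mod_cast hR0
      have h8 := mul_le_mul_of_nonneg_left h5.le h7
      linarith
    rw [Finset.sum_const, h2, nsmul_eq_mul] at h1
    have h9 := (hsum G hGB hGQ).le
    refine h1.trans ?_
    have hRr : (R : ℝ) = t₁ + n + M * P := by rw [hR]; push_cast; ring
    rw [← hRr]
    gcongr
  obtain ⟨M, hM⟩ := exists_nat_gt (2 * (k * (s.card + (t₁ + n) * (1 / (4 * (k + 1) * P)))))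
  have h1 := main M
  have h2 : k * (1 / (4 * (k + 1))) ≤ 1 / 4 := by
    rw [mul_one_div, div_le_div_iff₀ (by positivity) (by norm_num)]; linarith
  have h3 : P * (1 / (4 * (k + 1) * P)) = 1 / (4 * (k + 1)) := by field_simp
  have h4 : k * (M * (1 / (4 * (k + 1))) +
      (s.card + (t₁ + n + M * P) * (1 / (4 * (k + 1) * P)))) =
      k * (s.card + (t₁ + n) * (1 / (4 * (k + 1) * P))) + 2 * (M * (k * (1 / (4 * (k + 1))))) := by
    have : (t₁ + n + M * P) * (1 / (4 * (k + 1) * P)) =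
      (t₁ + n) * (1 / (4 * (k + 1) * P)) + M * (1 / (4 * (k + 1))) := by rw [← h3]; ring
    rw [this]; ring
  have h5 : (M : ℝ) * (k * (1 / (4 * (k + 1)))) ≤ M * (1 / 4) := by gcongr
  linarith

lemma XB_of_supp_subset {B : Set ℕ} {x y : ℤ → Bool} (hx : x ∈ XB B) (h : supp y ⊆ supp x) :
    y ∈ XB B := fun b hb =>
  let ⟨r, hr⟩ := hx b hb
  ⟨r, fun a ha => hr a (h ha)⟩

lemma XB_shiftPow {B : Set ℕ} {x : ℤ → Bool} (hx : x ∈ XB B) (t : ℤ) : shiftPow t x ∈ XB B := by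
  intro b hb
  obtain ⟨r, hr⟩ := hx b hb
  refine ⟨r - t, fun a ha hd => hr (a + t) ha ?_⟩
  convert hd using 1; ring

lemma isClosed_XB {B : Set ℕ} (hB : ∀ b ∈ B, 2 ≤ b) : IsClosed (XB B) := by
  have h : XB B = ⋂ b ∈ B, ⋃ r ∈ Finset.range b, ⋂ n : ℤ, ⋂ _ : (b : ℤ) ∣ n - (r : ℤ),
      {x : ℤ → Bool | x n = false} := by
    ext x
    simp only [XB, IsBAdmissible, supp, mem_ofPred_eq, mem_iInter, mem_iUnion, Finset.mem_range,
      exists_prop]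
    refine forall₂_congr fun b hb => ⟨fun ⟨r, hr⟩ => ?_, fun ⟨r, _, hr⟩ => ?_⟩
    · have hb0 : (0 : ℤ) < b := by have := hB b hb; omega
      have h0 := Int.emod_nonneg r hb0.ne'
      have h1 := Int.emod_lt_of_pos r hb0
      refine ⟨(r % b).toNat, by omega, fun n hn => ?_⟩
      rw [Int.toNat_of_nonneg h0] at hn
      by_contra hc
      refine hr n (by simpa using hc) ?_
      have : n - r = (n - r % b) - (r - r % b) := by ring
      rw [this]; exact dvd_sub hn Int.dvd_self_sub_emod
    · exact ⟨r, fun a ha hd => by simp [hr a hd] at ha⟩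
  rw [h]
  refine isClosed_biInter fun b _ => Set.Finite.isClosed_biUnion (Finset.finite_toSet _)
    fun r _ => isClosed_iInter fun n => isClosed_iInter fun _ =>
      isClosed_eq (continuous_apply n) continuous_const

lemma eta_mem_XB (B : Set ℕ) : eta B ∈ XB B := by
  intro b hb
  refine ⟨0, fun a ha => ?_⟩
  have : a ∈ BFreeSet B := by simpa [supp, eta] using ha
  simpa using this b hb

/-- A finite set is admissible once the moduli not exceeding its cardinality have been checked. -/
lemma isBAdmissible_of_finset {B : Set ℕ} (A : Finset ℤ)
    (h : ∀ b ∈ B, b ≤ A.card → ∃ r : ℤ, ∀ a ∈ A, ¬ (b : ℤ) ∣ a - r) :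
    IsBAdmissible B A := by
  intro b hb
  by_cases hbA : b ≤ A.card
  · exact h b hb hbA
  by_contra! hcon
  choose f hfA hf using hcon
  have hinj : Set.InjOn (fun r : ℕ => f r) (Finset.range b : Set ℕ) := by
    intro r hr s hs hrs
    have h1 := hf r
    have h2 := hf s
    simp only at hrs
    rw [hrs] at h1
    have h3 := dvd_sub h1 h2
    have h4 : (f s - r) - (f s - s) = (s : ℤ) - r := by ring
    rw [h4] at h3
    have := Nat.modEq_iff_dvd.2 h3
    simp only [Finset.coe_range, mem_Iio] at hr hs
    exact this.eq_of_lt_of_lt hr hs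
  have := Finset.card_le_card_of_injOn (fun r : ℕ => f r) (fun r _ => hfA r) hinj
  simp at this
  omega

lemma exists_injective_large {B : Set ℕ} (hB : B.Infinite) (N : ℕ) :
    ∃ β : ℤ → ℕ, Function.Injective β ∧ ∀ j, β j ∈ B ∧ N < β j := by
  have hinf : (B \ Set.Iic N).Infinite := hB.sdiff (Set.finite_Iic N)
  obtain ⟨e⟩ : Nonempty (ℤ ≃ ℕ) := ⟨Equiv.intEquivNat⟩
  have := hinf.to_subtype
  refine ⟨fun j => (Infinite.natEmbedding ↥(B \ Set.Iic N) (e j) : ℕ), fun a b hab => ?_,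
    fun j => ?_⟩
  · exact e.injective ((Infinite.natEmbedding _).injective (Subtype.ext hab))
  · have := (Infinite.natEmbedding ↥(B \ Set.Iic N) (e j)).2
    exact ⟨this.1, by simpa using this.2⟩

/-- Every finite pattern of an admissible sequence occurs in `η`. -/
lemma exists_eta_eq {B : Set ℕ} (hB : IsErdos B) {x : ℤ → Bool} (hx : x ∈ XB B) (n : ℕ) :
    ∃ t : ℤ, ∀ i ∈ Finset.Icc (-n : ℤ) n, eta B (i + t) = x i := by
  classical
  set A : Finset ℤ := (Finset.Icc (-n : ℤ) n).filter fun i => x i = true with hA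
  obtain ⟨s, hsB, hs⟩ := exists_finset_tail hB (ε := 1 / (4 * (A.card + 1))) (by positivity)
  obtain ⟨β, hβ, hβB⟩ := exists_injective_large hB.1 (2 * n + ∑ b ∈ s, b)
  set J : Finset ℤ := (Finset.Icc (-n : ℤ) n).filter fun i => ¬ x i = true with hJ
  have hβs : ∀ j, β j ∉ s := fun j hj => by
    have h1 : β j ≤ ∑ b ∈ s, b :=
      Finset.single_le_sum (f := fun b : ℕ => b) (fun _ _ => Nat.zero_le _) hj
    have h2 := (hβB j).2
    omega
  choose! g hg using hx
  set Q : Finset ℕ := s ∪ J.image β with hQ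
  have hQB : (↑Q : Set ℕ) ⊆ B := by
    intro b hb
    simp only [hQ, Finset.coe_union, Finset.coe_image] at hb
    rcases hb with hb | ⟨j, _, rfl⟩
    exacts [hsB hb, (hβB j).1]
  obtain ⟨t₀, ht₀⟩ := crt Q (fun b hb => by have := hB.2.1 b (hQB hb); omega)
    (fun a ha b hb => hB.2.2.2.1 a (hQB ha) b (hQB hb))
    (fun b => if b ∈ s then - g b else - (Function.invFun β b))
  obtain ⟨t, htP, ht⟩ := exists_avoiding hB A Q hQB
    (fun F hF hd => hs F hF (hd.mono_right Finset.subset_union_left)) t₀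
  have htQ : ∀ b ∈ Q, (b : ℤ) ∣ t - (if b ∈ s then - g b else - (Function.invFun β b)) := by
    intro b hb
    have h1 := (Finset.dvd_prod_of_mem (fun b : ℕ => (b : ℤ)) hb).trans htP
    have := dvd_add h1 (ht₀ b hb)
    rwa [sub_add_sub_cancel] at this
  have htJ : ∀ j ∈ J, (β j : ℤ) ∣ t + j := by
    intro j hj
    have := htQ (β j) (Finset.mem_union_right _ (Finset.mem_image_of_mem _ hj))
    rw [if_neg (hβs j), Function.leftInverse_invFun hβ j] at this
    simpa using this
  refine ⟨t, fun i hi => ?_⟩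
  by_cases hxi : x i = true
  · rw [hxi]
    have hiA : i ∈ A := Finset.mem_filter.2 ⟨hi, hxi⟩
    have : i + t ∈ BFreeSet B := by
      intro b hb hd
      by_cases hbQ : b ∈ Q
      · by_cases hbs : b ∈ s
        · have h1 := htQ b hbQ
          rw [if_pos hbs] at h1
          refine hg b hb i hxi ?_
          have h2 : i - g b = (i + t) - (t - -g b) := by ring
          rw [h2]; exact dvd_sub hd h1
        · obtain ⟨j, hj, rfl⟩ := Finset.mem_image.1 ((Finset.mem_union.1 hbQ).resolve_left hbs)
          have h1 := dvd_sub hd (htJ j hj)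
          have h2 : (i + t) - (t + j) = i - j := by ring
          rw [h2] at h1
          have h3 := (hβB j).2
          rw [hJ, Finset.mem_filter, Finset.mem_Icc] at hj
          rw [Finset.mem_Icc] at hi
          have h4 : i - j = 0 := Int.eq_zero_of_abs_lt_dvd h1 (by rw [abs_lt]; constructor <;> omega)
          have h5 : i = j := by omega
          exact hj.2 (h5 ▸ hxi)
      · exact ht b hb hbQ i hiA (by rwa [add_comm])
    simp [eta, this]
  · have hiJ : i ∈ J := Finset.mem_filter.2 ⟨hi, hxi⟩
    have : i + t ∉ BFreeSet B := fun h => h _ (hβB i).1 (by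
      rw [add_comm i t]; exact htJ i hiJ)
    simp [eta, this, hxi]

lemma exists_radius_of_finset (I : Finset ℤ) : ∃ n : ℕ, ∀ i ∈ I, i ∈ Finset.Icc (-n : ℤ) n := by
  refine ⟨∑ a ∈ I, a.natAbs, fun a ha => ?_⟩
  have : a.natAbs ≤ ∑ a ∈ I, a.natAbs :=
    Finset.single_le_sum (f := fun a : ℤ => a.natAbs) (fun _ _ => Nat.zero_le _) ha
  rw [Finset.mem_Icc]
  omega

lemma exists_cylinder_subset {U : Set (ℤ → Bool)} {x : ℤ → Bool} (hU : U ∈ nhds x) :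
    ∃ n : ℕ, ∀ y : ℤ → Bool, (∀ i ∈ Finset.Icc (-n : ℤ) n, y i = x i) → y ∈ U := by
  obtain ⟨V, hVU, hV, hxV⟩ := mem_nhds_iff.1 hU
  obtain ⟨I, u, hu, hIU⟩ := isOpen_pi_iff.1 hV x hxV
  obtain ⟨n, hn⟩ := exists_radius_of_finset I
  refine ⟨n, fun y hy => hVU (hIU fun i hi => ?_)⟩
  rw [hy i (hn i hi)]
  exact (hu i hi).2

lemma cylinder_mem_nhds (x : ℤ → Bool) (n : ℕ) :
    {y : ℤ → Bool | ∀ i ∈ Finset.Icc (-n : ℤ) n, y i = x i} ∈ nhds x := by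
  have h : {y : ℤ → Bool | ∀ i ∈ Finset.Icc (-n : ℤ) n, y i = x i} =
      ⋂ i ∈ Finset.Icc (-n : ℤ) n, {y : ℤ → Bool | y i = x i} := by ext; simp
  rw [h, Finset.iInter_mem_sets]
  intro i _
  exact (continuous_apply i).continuousAt.eventually_mem (isOpen_discrete {x i} |>.mem_nhds rfl)

theorem Xeta_eq_XB {B : Set ℕ} (hB : IsErdos B) : Xeta B = XB B := by
  refine Subset.antisymm (closure_minimal ?_ (isClosed_XB hB.2.1)) fun x hx => ?_
  · rintro _ ⟨t, rfl⟩
    exact XB_shiftPow (eta_mem_XB B) t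
  · refine mem_closure_iff_nhds.2 fun U hU => ?_
    obtain ⟨n, hn⟩ := exists_cylinder_subset hU
    obtain ⟨t, ht⟩ := exists_eta_eq hB hx n
    exact ⟨shiftPow t (eta B), hn _ ht, t, rfl⟩

lemma IsCA.shiftPow_comm {X : Set (ℤ → Bool)} {τ : (ℤ → Bool) → ℤ → Bool} (hτ : IsCA X τ)
    (hX : ∀ x ∈ X, ∀ t, shiftPow t x ∈ X) {x : ℤ → Bool} (hx : x ∈ X) (t : ℤ) :
    τ (shiftPow t x) = shiftPow t (τ x) := by
  have hadd : ∀ (s t : ℤ) (x : ℤ → Bool), shiftPow s (shiftPow t x) = shiftPow (s + t) x := by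
    intro s t x; funext n; simp [shiftPow, add_assoc]
  have hzero : ∀ x : ℤ → Bool, shiftPow 0 x = x := fun x => by funext n; simp [shiftPow]
  have hstep : ∀ x ∈ X, τ (shiftPow 1 x) = shiftPow 1 (τ x) := hτ.2.2
  have hinj : ∀ x y : ℤ → Bool, shiftPow 1 x = shiftPow 1 y → x = y := by
    intro x y h
    have := congrArg (shiftPow (-1)) h
    simpa only [hadd, neg_add_cancel, hzero] using this
  induction t using Int.induction_on with
  | zero => simp [hzero]
  | succ n ih => rw [add_comm, ← hadd, hstep _ (hX x hx _), ih, hadd]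
  | pred n ih =>
    apply hinj
    rw [← hstep _ (hX x hx _), hadd, hadd]
    simpa using ih

/-- Curtis–Hedlund–Lyndon: a cellular automaton has a finite radius. -/
lemma IsCA.exists_hasRadius {X : Set (ℤ → Bool)} {τ : (ℤ → Bool) → ℤ → Bool} (hτ : IsCA X τ)
    (hcl : IsClosed X) (hX : ∀ x ∈ X, ∀ t, shiftPow t x ∈ X) : ∃ ℓ : ℕ, HasRadius X τ ℓ := by
  obtain ⟨ℓ, hℓ⟩ : ∃ ℓ : ℕ, ∀ x ∈ X, ∀ y ∈ X,
      (∀ i ∈ Finset.Icc (-ℓ : ℤ) ℓ, y i = x i) → τ y 0 = τ x 0 := by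
    refine hcl.isCompact.induction_on (p := fun s => ∃ n : ℕ, ∀ x ∈ s, ∀ y ∈ X, x ∈ X →
      (∀ i ∈ Finset.Icc (-n : ℤ) n, y i = x i) → τ y 0 = τ x 0) ⟨0, by simp⟩ ?_ ?_ ?_ |>.imp
      fun n h x hx y hy => h x hx y hy hx
    · rintro s t hst ⟨n, hn⟩
      exact ⟨n, fun x hx => hn x (hst hx)⟩
    · rintro s t ⟨n, hn⟩ ⟨m, hm⟩
      refine ⟨max n m, fun x hx y hy hxX h => ?_⟩
      rcases hx with hx | hx
      · refine hn x hx y hy hxX fun i hi => h i ?_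
        simp only [Finset.mem_Icc] at hi ⊢; push_cast; omega
      · refine hm x hx y hy hxX fun i hi => h i ?_
        simp only [Finset.mem_Icc] at hi ⊢; push_cast; omega
    · intro x hx
      have h1 : {z : ℤ → Bool | z 0 = τ x 0} ∈ nhds (τ x) :=
        (continuous_apply 0).continuousAt.eventually_mem (isOpen_discrete {τ x 0} |>.mem_nhds rfl)
      obtain ⟨U, hU, hUX⟩ := mem_nhdsWithin_iff_exists_mem_nhds_inter.1 (hτ.2.1 x hx h1)
      obtain ⟨n, hn⟩ := exists_cylinder_subset hU
      refine ⟨_, mem_nhdsWithin_of_mem_nhds (cylinder_mem_nhds x n), n, fun x' hx' y hy hx'X h => ?_⟩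
      have h2 : τ x' 0 = τ x 0 := hUX ⟨hn x' hx', hx'X⟩
      have h3 : τ y 0 = τ x 0 := hUX ⟨hn y fun i hi => (h i hi).trans (hx' i hi), hy⟩
      rw [h2, h3]
  refine ⟨ℓ, fun x hx y hy n h => ?_⟩
  have h1 := hℓ _ (hX y hy n) _ (hX x hx n) (fun i hi => by
    rw [Finset.mem_Icc] at hi
    exact h (i + n) (by omega) (by omega))
  rw [hτ.shiftPow_comm hX hx, hτ.shiftPow_comm hX hy] at h1
  simpa [shiftPow] using h1

/-- A cellular automaton on the admissible subshift lies below a power of the shift. -/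
lemma exists_le_shift {B : Set ℕ} (hB : IsErdos B) {τ : (ℤ → Bool) → ℤ → Bool}
    (hτ : IsCA (XB B) τ) :
    ∃ k : ℤ, ∀ x ∈ XB B, ∀ n, τ x n = true → x (n + k) = true := by
  classical
  have hX : ∀ x ∈ XB B, ∀ t, shiftPow t x ∈ XB B := fun x hx t => XB_shiftPow hx t
  obtain ⟨ℓ, hℓ⟩ := hτ.exists_hasRadius (isClosed_XB hB.2.1) hX
  suffices h : ∃ k : ℤ, ∀ x ∈ XB B, τ x 0 = true → x k = true by
    obtain ⟨k, hk⟩ := h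
    refine ⟨k, fun x hx n hn => ?_⟩
    have := hk _ (hX x hx n) (by
      rw [hτ.shiftPow_comm hX hx]
      simpa [shiftPow] using hn)
    rw [add_comm]; exact this
  by_contra! hcon
  choose x hxX hx1 hx0 using hcon
  choose g hg using hxX
  obtain ⟨β, -, hβ⟩ := exists_injective_large hB.1 (2 * ℓ + 1)
  obtain ⟨hbB, hbℓ⟩ := hβ 0
  set b := β 0
  set W : Finset ℤ := Finset.Icc (-ℓ : ℤ) ℓ with hW
  set N : ℕ := b * W.card with hN
  set Q : Finset ℕ := insert b ((Finset.range (N + 1)).filter (· ∈ B)) with hQ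
  have hQB : ∀ q ∈ Q, q ∈ B := by
    intro q hq
    rcases Finset.mem_insert.1 hq with rfl | hq
    exacts [hbB, (Finset.mem_filter.1 hq).2]
  -- position `i` carries the pattern of a point with a zero at `i - ℓ`
  obtain ⟨p, hpQ, -, hp⟩ := exists_sparse_positions (ι := Fin b) Q
    (fun q hq => by have := hB.2.1 q (hQB q hq); omega)
    (fun q hq q' hq' => hB.2.2.2.1 q (hQB q hq) q' (hQB q' hq'))
    (fun i q => if q = b then -((i : ℕ) - ℓ : ℤ) else
      if h : q ∈ B then - g ((i : ℕ) - ℓ : ℤ) q h else 0) (2 * ℓ)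
  set A : Finset ℤ := Finset.univ.biUnion fun i : Fin b =>
    (W.filter fun d => x ((i : ℕ) - ℓ) d = true).image (· + p i) with hA
  have hmemA : ∀ a, a ∈ A ↔ ∃ i : Fin b, ∃ d ∈ W, x ((i : ℕ) - ℓ) d = true ∧ d + p i = a := by
    intro a
    simp only [hA, Finset.mem_biUnion, Finset.mem_univ, true_and, Finset.mem_image,
      Finset.mem_filter, and_assoc]
  have hAcard : A.card ≤ N := by
    refine Finset.card_biUnion_le.trans ((Finset.sum_le_card_nsmul _ _ W.card fun i _ =>
      Finset.card_image_le.trans (Finset.card_filter_le _ _)).trans ?_)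
    simp [hN]
  have hAX : indSeq A ∈ XB B := by
    change IsBAdmissible B (supp (indSeq A))
    rw [supp_indSeq]
    refine isBAdmissible_of_finset A fun q hqB hqA => ⟨0, fun a ha hd => ?_⟩
    have hqQ : q ∈ Q := Finset.mem_insert_of_mem
      (Finset.mem_filter.2 ⟨Finset.mem_range.2 (by omega), hqB⟩)
    obtain ⟨i, d, hdW, hxd, rfl⟩ := (hmemA a).1 ha
    have h1 := hpQ i q hqQ
    rw [sub_zero] at hd
    have h2 := dvd_sub hd h1
    split_ifs at h1 h2 with hqb
    · rw [hqb] at h2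
      have h3 : d + p i - (p i - -((i : ℕ) - ℓ : ℤ)) = d - ((i : ℕ) - ℓ) := by ring
      rw [h3] at h2
      rw [hW, Finset.mem_Icc] at hdW
      have h4 : d - ((i : ℕ) - ℓ) = 0 := Int.eq_zero_of_abs_lt_dvd h2 (by
        have := i.2
        rw [abs_lt]; constructor <;> omega)
      have h5 : d = (i : ℕ) - ℓ := by omega
      rw [h5] at hxd
      exact hx0 _ hxd
    · have h3 : d + p i - (p i - -g ((i : ℕ) - ℓ) q hqB) = d - g ((i : ℕ) - ℓ) q hqB := by ring
      rw [h3] at h2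
      exact hg _ q hqB d hxd h2
  have hτA : ∀ i, τ (indSeq A) (p i) = true := by
    intro i
    have hxi : x ((i : ℕ) - ℓ) ∈ XB B := fun q hq => ⟨_, hg _ q hq⟩
    have h1 : τ (indSeq A) (p i) = τ (shiftPow (-p i) (x ((i : ℕ) - ℓ))) (p i) := by
      refine hℓ _ hAX _ (hX _ hxi _) _ fun m hm1 hm2 => ?_
      rw [Bool.eq_iff_iff, indSeq_eq_true, Finset.mem_coe, hmemA]
      constructor
      · rintro ⟨j, d, hdW, hxd, hdm⟩
        have hij : j = i := by
          by_contra hij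
          have h2 := hp j i hij
          rw [hW, Finset.mem_Icc] at hdW
          refine absurd h2 (not_lt.2 ?_)
          rw [abs_le]; push_cast; constructor <;> omega
        subst hij
        simp only [shiftPow]
        rwa [← hdm, add_neg_cancel_right]
      · intro h
        exact ⟨i, m + -p i, by rw [hW, Finset.mem_Icc]; constructor <;> omega, h, by ring⟩
    rw [h1, hτ.shiftPow_comm hX hxi]
    simpa [shiftPow] using hx1 _
  obtain ⟨r, hr⟩ := hτ.1 hAX b hbB
  have hb0 : (0 : ℤ) < b := by omega
  have h0 := Int.emod_nonneg (ℓ - r) hb0.ne'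
  have h1 := Int.emod_lt_of_pos (ℓ - r : ℤ) hb0
  let i : Fin b := ⟨((ℓ - r) % b : ℤ).toNat, by omega⟩
  have hi : ((i : ℕ) : ℤ) = (ℓ - r) % b := Int.toNat_of_nonneg h0
  refine hr (p i) (hτA i) ?_
  have h2 := hpQ i b (Finset.mem_insert_self _ _)
  simp only [if_true] at h2
  have h3 : (b : ℤ) ∣ (ℓ - r) - (ℓ - r) % b := Int.dvd_self_sub_emod
  rw [← hi] at h3
  have h4 : p i - r = (p i - -((i : ℕ) - ℓ : ℤ)) + ((ℓ - r) - (i : ℕ)) := by ring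
  rw [h4]
  exact dvd_add h2 h3

/-- A finite window of an admissible `x` can be completed to an admissible `y` such that every
admissible sequence above `y` coincides with `x` on the window. -/
lemma exists_forcing {B : Set ℕ} (hB : IsErdos B) {x : ℤ → Bool} (hx : x ∈ XB B) (L : ℕ) {k : ℤ}
    (hk : k ∈ Finset.Icc (-L : ℤ) L) (hxk : x k = true) :
    ∃ y ∈ XB B, y k = true ∧ ∀ z ∈ XB B, (∀ n, y n = true → z n = true) →
      ∀ i ∈ Finset.Icc (-L : ℤ) L, z i = x i := by
  classical
  set W : Finset ℤ := Finset.Icc (-L : ℤ) L with hW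
  obtain ⟨β, hβ, hβB⟩ := exists_injective_large hB.1 (2 * L + 1)
  choose! g hg using hx
  set C : Finset ℤ := W.filter fun i => x i = true with hC
  set J : Finset ℤ := W.filter fun i => ¬ x i = true with hJ
  have hkC : k ∈ C := Finset.mem_filter.2 ⟨hk, hxk⟩
  set I : Finset (Σ _ : ℤ, ℕ) := J.sigma fun j =>
    (Finset.range (β j)).filter fun r : ℕ => ¬ (β j : ℤ) ∣ r - j with hI
  set N : ℕ := C.card + I.card with hN
  set Q : Finset ℕ := J.image β ∪ (Finset.range (N + 1)).filter (· ∈ B) with hQ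
  have hQB : ∀ q ∈ Q, q ∈ B := by
    intro q hq
    rcases Finset.mem_union.1 hq with hq | hq
    · obtain ⟨j, -, rfl⟩ := Finset.mem_image.1 hq
      exact (hβB j).1
    · exact (Finset.mem_filter.1 hq).2
  obtain ⟨p, hpQ, hpL, -⟩ := exists_sparse_positions (ι := I) Q
    (fun q hq => by have := hB.2.1 q (hQB q hq); omega)
    (fun q hq q' hq' => hB.2.2.2.1 q (hQB q hq) q' (hQB q' hq'))
    (fun i q => if q = β i.1.1 then i.1.2 else k) L
  set A : Finset ℤ := C ∪ Finset.univ.image p with hA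
  have hAcard : A.card ≤ N := by
    refine (Finset.card_union_le _ _).trans (Nat.add_le_add_left ?_ _)
    exact Finset.card_image_le.trans (by simp)
  have hdist : ∀ c ∈ C, ∀ j ∈ J, ¬ (β j : ℤ) ∣ c - j := by
    intro c hc j hj hd
    rw [hC, Finset.mem_filter, hW, Finset.mem_Icc] at hc
    rw [hJ, Finset.mem_filter, hW, Finset.mem_Icc] at hj
    have h2 := (hβB j).2
    have h1 : c - j = 0 := Int.eq_zero_of_abs_lt_dvd hd (by rw [abs_lt]; constructor <;> omega)
    have h3 : c = j := by omega
    exact hj.2 (h3 ▸ hc.2)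
  have hAX : indSeq A ∈ XB B := by
    change IsBAdmissible B (supp (indSeq A))
    rw [supp_indSeq]
    refine isBAdmissible_of_finset A fun q hqB hqA => ?_
    have hqQ : q ∈ Q := Finset.mem_union_right _
      (Finset.mem_filter.2 ⟨Finset.mem_range.2 (by omega), hqB⟩)
    by_cases hqJ : q ∈ J.image β
    · obtain ⟨j, hj, rfl⟩ := Finset.mem_image.1 hqJ
      refine ⟨j, fun a ha hd => ?_⟩
      rcases Finset.mem_union.1 ha with ha | ha
      · exact hdist a ha j hj hd
      · obtain ⟨i, -, rfl⟩ := Finset.mem_image.1 ha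
        have h2 := dvd_sub hd (hpQ i _ hqQ)
        rw [sub_sub_sub_cancel_left] at h2
        split_ifs at h2 with hji
        · have h3 := (Finset.mem_filter.1 (Finset.mem_sigma.1 i.2).2).2
          rw [← hβ hji] at h3
          exact h3 h2
        · exact hdist k hkC j hj h2
    · refine ⟨g q, fun a ha hd => ?_⟩
      rcases Finset.mem_union.1 ha with ha | ha
      · exact hg q hqB a (Finset.mem_filter.1 ha).2 hd
      · obtain ⟨i, -, rfl⟩ := Finset.mem_image.1 ha
        have h2 := dvd_sub hd (hpQ i _ hqQ)
        have hne : q ≠ β i.1.1 := fun h => hqJ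
          (h ▸ Finset.mem_image_of_mem _ (Finset.mem_sigma.1 i.2).1)
        rw [sub_sub_sub_cancel_left, if_neg hne] at h2
        exact hg q hqB k hxk h2
  refine ⟨indSeq A, hAX, indSeq_eq_true.2 (Finset.mem_union_left _ hkC), fun z hz hle i hi => ?_⟩
  by_cases hxi : x i = true
  · rw [hxi]
    exact hle i (indSeq_eq_true.2 (Finset.mem_union_left _ (Finset.mem_filter.2 ⟨hi, hxi⟩)))
  · have hiJ : i ∈ J := Finset.mem_filter.2 ⟨hi, hxi⟩
    obtain ⟨r, hr⟩ := hz (β i) (hβB i).1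
    have hb0 : (0 : ℤ) < β i := by have := (hβB i).2; omega
    have h0 := Int.emod_nonneg r hb0.ne'
    have h1 := Int.emod_lt_of_pos r hb0
    have hs : (((r % β i).toNat : ℕ) : ℤ) = r % β i := Int.toNat_of_nonneg h0
    have hrs : (β i : ℤ) ∣ r - r % β i := Int.dvd_self_sub_emod
    have hri : (β i : ℤ) ∣ r % β i - i := by
      by_contra hnd
      have hmem : (⟨i, (r % β i).toNat⟩ : Σ _ : ℤ, ℕ) ∈ I := Finset.mem_sigma.2
        ⟨hiJ, Finset.mem_filter.2 ⟨Finset.mem_range.2 (show (r % β i).toNat < β i by omega), by rwa [hs]⟩⟩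
      have h2 := hpQ ⟨_, hmem⟩ (β i) (Finset.mem_union_left _ (Finset.mem_image_of_mem _ hiJ))
      simp only [if_true] at h2
      rw [hs] at h2
      refine hr (p ⟨_, hmem⟩) (hle _ (indSeq_eq_true.2 (Finset.mem_union_right _
        (Finset.mem_image_of_mem _ (Finset.mem_univ _))))) ?_
      have := dvd_sub h2 hrs
      rwa [sub_sub_sub_cancel_right] at this
    have hzi : ¬ z i = true := fun h => hr i h (by
      have := (dvd_add hrs hri).neg_right
      rwa [sub_add_sub_cancel, neg_sub] at this)
    simp only [Bool.not_eq_true] at hxi hzi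
    rw [hxi, hzi]

/-- A cellular automaton below a power of the shift which is surjective equals that power. -/
lemma eq_shift_of_surjOn {B : Set ℕ} (hB : IsErdos B) {τ : (ℤ → Bool) → ℤ → Bool}
    (hτ : IsCA (XB B) τ) {k : ℤ} (hk : ∀ x ∈ XB B, ∀ n, τ x n = true → x (n + k) = true)
    (hs : SurjOn τ (XB B) (XB B)) : ∀ x ∈ XB B, τ x = shiftPow k x := by
  have hX : ∀ x ∈ XB B, ∀ t, shiftPow t x ∈ XB B := fun x hx t => XB_shiftPow hx t
  obtain ⟨ℓ, hℓ⟩ := hτ.exists_hasRadius (isClosed_XB hB.2.1) hX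
  have key : ∀ x ∈ XB B, x k = true → τ x 0 = true := by
    intro x hx hxk
    obtain ⟨y, hy, hyk, hforce⟩ := exists_forcing hB hx (ℓ + k.natAbs) (k := k)
      (by rw [Finset.mem_Icc]; omega) hxk
    obtain ⟨z, hz, hzy⟩ := hs (hX y hy k)
    have hzx := hforce z hz fun n hn => by
      have := hk z hz (n - k) (by rw [hzy]; simpa [shiftPow] using hn)
      simpa using this
    rw [hℓ x hx z hz 0 fun i h1 h2 => (hzx i (by
      rw [Finset.mem_Icc]; omega)).symm, hzy]
    simpa [shiftPow] using hyk
  intro x hx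
  funext n
  rw [Bool.eq_iff_iff]
  refine ⟨hk x hx n, fun h => ?_⟩
  have := key _ (hX x hx n) (by simpa [shiftPow, add_comm] using h)
  rw [hτ.shiftPow_comm hX hx] at this
  simpa [shiftPow] using this

/-- A cellular automaton below a power of the shift which is pre-injective equals that power. -/
lemma eq_shift_of_preInjective {B : Set ℕ} (hB : IsErdos B) {τ : (ℤ → Bool) → ℤ → Bool}
    (hτ : IsCA (XB B) τ) {k : ℤ} (hk : ∀ x ∈ XB B, ∀ n, τ x n = true → x (n + k) = true)
    (hp : PreInjective (XB B) τ) : ∀ x ∈ XB B, τ x = shiftPow k x := by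
  classical
  have hX : ∀ x ∈ XB B, ∀ t, shiftPow t x ∈ XB B := fun x hx t => XB_shiftPow hx t
  obtain ⟨ℓ, hℓ⟩ := hτ.exists_hasRadius (isClosed_XB hB.2.1) hX
  have hfin : ∀ C : Finset ℤ, indSeq C ∈ XB B → τ (indSeq C) = shiftPow k (indSeq C) := by
    intro C
    induction C using Finset.strongInduction with
    | H C ih =>
      intro hC
      set D : Finset ℤ := C.filter fun c => τ (indSeq C) (c - k) = true with hD
      have hDC : D ⊆ C := Finset.filter_subset _ _
      have hτC : τ (indSeq C) = shiftPow k (indSeq D) := by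
        funext n
        rw [Bool.eq_iff_iff]
        simp only [shiftPow, indSeq_eq_true, Finset.mem_coe, hD, Finset.mem_filter,
          add_sub_cancel_right]
        exact ⟨fun h => ⟨by simpa [indSeq_eq_true] using hk _ hC n h, h⟩, fun h => h.2⟩
      rcases hDC.eq_or_ssubset with h | h
      · rw [hτC, h]
      · have hDX : indSeq D ∈ XB B := XB_of_supp_subset hC (by
          rw [supp_indSeq, supp_indSeq]; exact_mod_cast hDC)
        have hDC' : indSeq (D : Set ℤ) = indSeq C := by
          refine hp _ hDX _ hC ((ih D h hDX).trans hτC.symm) (C.finite_toSet.subset fun n hn => ?_)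
          by_contra hnC
          have hnD : n ∉ D := fun h => hnC (hDC h)
          refine hn (?_ : indSeq (D : Set ℤ) n = indSeq C n)
          rw [Bool.eq_iff_iff, indSeq_eq_true, indSeq_eq_true]
          exact iff_of_false hnD hnC
        rw [hτC, hDC']
  have key : ∀ x ∈ XB B, τ x 0 = x k := by
    intro x hx
    set L : ℕ := ℓ + k.natAbs
    set C : Finset ℤ := (Finset.Icc (-L : ℤ) L).filter fun i => x i = true with hC
    have hCx : ∀ i ∈ Finset.Icc (-L : ℤ) L, indSeq C i = x i := by
      intro i hi
      rw [Bool.eq_iff_iff, indSeq_eq_true, Finset.mem_coe, hC, Finset.mem_filter]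
      exact ⟨fun h => h.2, fun h => ⟨hi, h⟩⟩
    have hCX : indSeq C ∈ XB B := XB_of_supp_subset hx (by
      rw [supp_indSeq]; intro i hi; exact (Finset.mem_filter.1 hi).2)
    rw [hℓ x hx _ hCX 0 fun i h1 h2 => (hCx i (by rw [Finset.mem_Icc]; omega)).symm,
      hfin C hCX]
    simpa [shiftPow] using hCx k (by rw [Finset.mem_Icc]; omega)
  intro x hx
  funext n
  have := key _ (hX x hx n)
  rw [hτ.shiftPow_comm hX hx] at this
  simpa [shiftPow, add_comm] using this

/-- On the `B`-free subshift of an Erdős set `B`, the Garden of Eden theorem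
holds: a CA is surjective iff it is pre-injective. -/
theorem garden_of_eden_erdos (B : Set ℕ) (hB : IsErdos B)
    (τ : (ℤ → Bool) → (ℤ → Bool)) (hτ : IsCA (Xeta B) τ) :
    Set.SurjOn τ (Xeta B) (Xeta B) ↔ PreInjective (Xeta B) τ := by
  rw [Xeta_eq_XB hB] at hτ ⊢
  obtain ⟨k, hk⟩ := exists_le_shift hB hτ
  have hinv : ∀ x : ℤ → Bool, shiftPow k (shiftPow (-k) x) = x := fun x => by
    funext n; simp [shiftPow]
  constructor
  · intro hs x hx y hy hxy _
    have h := eq_shift_of_surjOn hB hτ hk hs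
    rw [h x hx, h y hy] at hxy
    funext n
    simpa [shiftPow] using congrFun hxy (n - k)
  · intro hp y hy
    have h := eq_shift_of_preInjective hB hτ hk hp
    have hy' := XB_shiftPow hy (-k)
    exact ⟨_, hy', by rw [h _ hy', hinv]⟩
end

section
/- (Maximality of η.) Let (X_η, S) be a B-free subshift. If y ∈ X_η and η(n) ≤ y(n) for all n ∈ ℤ, then y = η. -/
open Filter Set

theorem eta_eq_true_iff (B : Set ℕ) (n : ℤ) : eta B n = true ↔ n ∈ BFreeSet B := by
  simp [eta]

/-- A point of the `B`-free subshift agrees with a shift of `η` on any finite window. -/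
theorem exists_shift_eq_of_mem_Xeta {B : Set ℕ} {y : ℤ → Bool} (hy : y ∈ Xeta B)
    (W : Finset ℤ) : ∃ t : ℤ, ∀ i ∈ W, eta B (i + t) = y i := by
  have hopen : IsOpen (Set.pi (W : Set ℤ) fun i => ({y i} : Set Bool)) :=
    isOpen_set_pi W.finite_toSet fun _ _ => isOpen_discrete _
  obtain ⟨_, hx, t, rfl⟩ := mem_closure_iff.1 hy _ hopen fun i _ => rfl
  exact ⟨t, fun i hi => hx i hi⟩

/-- Finitely many integers of `A` represent all residue classes mod `b` met by `A`. -/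
theorem exists_finset_residues (A : Set ℤ) {b : ℤ} (hb : 0 < b) :
    ∃ W : Finset ℤ, (W : Set ℤ) ⊆ A ∧ ∀ x ∈ A, ∃ w ∈ W, b ∣ w - x := by
  have hfin : ((· % b) '' A).Finite := (Set.finite_Ico 0 b).subset <| by
    rintro _ ⟨x, -, rfl⟩
    exact ⟨Int.emod_nonneg x hb.ne', Int.emod_lt_of_pos x hb⟩
  obtain ⟨W, hWA, hW⟩ := Set.exists_subset_image_finite_and.1 ⟨_, subset_rfl, hfin, rfl⟩
  refine ⟨hW.1.toFinset, by simpa using hWA, fun x hx => ?_⟩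
  obtain ⟨w, hw, hwx⟩ := hW.2.symm ▸ Set.mem_image_of_mem (· % b) hx
  exact ⟨w, by simpa using hw, Int.ModEq.dvd (Eq.symm hwx)⟩

/-- If the residues mod `b ∈ B` of the `B`-free integers are stable under translation by `t`,
then `b` divides `t`. -/
theorem dvd_of_residues_stable {B : Set ℕ} (hBprim : Primitive B) {b : ℕ} (hb : b ∈ B)
    (hb0 : 0 < b) {t : ℤ}
    (ht : ∀ x ∈ BFreeSet B, ∃ z ∈ BFreeSet B, (b : ℤ) ∣ z - (x + t)) : (b : ℤ) ∣ t := by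
  have iter : ∀ k : ℕ, ∀ x ∈ BFreeSet B, ∃ z ∈ BFreeSet B, (b : ℤ) ∣ z - (x + k * t) := by
    intro k
    induction k with
    | zero => exact fun x hx => ⟨x, hx, by simp⟩
    | succ k ih =>
      intro x hx
      obtain ⟨z, hz, hzx⟩ := ih x hx
      obtain ⟨w, hw, hwz⟩ := ht z hz
      refine ⟨w, hw, ?_⟩
      have heq : w - (x + (k + 1 : ℕ) * t) = w - (z + t) + (z - (x + k * t)) := by
        push_cast
        ring
      exact heq ▸ dvd_add hwz hzx
  by_contra hbt
  have hg : (Int.gcd b t : ℤ) ∈ BFreeSet B := by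
    intro a ha hag
    obtain rfl := hBprim a ha b hb (Int.natCast_dvd_natCast.1 (hag.trans (Int.gcd_dvd_left _ _)))
    exact hbt (hag.trans (Int.gcd_dvd_right _ _))
  set v := Int.gcdB b t
  obtain ⟨z, hz, hzx⟩ := iter ((-v) % b).toNat _ hg
  have hb' : (b : ℤ) ≠ 0 := by exact_mod_cast hb0.ne'
  rw [Int.toNat_of_nonneg (Int.emod_nonneg _ hb'), Int.gcd_eq_gcd_ab, Int.emod_def] at hzx
  refine hz b hb ((dvd_iff_dvd_of_dvd_sub hzx).2 ⟨Int.gcdA b t - (-v / b) * t, ?_⟩)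
  ring

/-- Maximality of `η` in the `B`-free subshift. -/
theorem eta_maximal (B : Set ℕ) (hBpos : ∀ b ∈ B, 2 ≤ b) (hBprim : Primitive B)
    (y : ℤ → Bool) (hy : y ∈ Xeta B) (hle : ∀ n : ℤ, eta B n ≤ y n) :
    y = eta B := by
  funext n
  by_contra hne
  have hyn : y n = true ∧ n ∉ BFreeSet B := by
    have := hle n
    rw [← eta_eq_true_iff]
    revert this hne
    cases y n <;> cases eta B n <;> simp
  obtain ⟨b, hb, hbn⟩ : ∃ b ∈ B, (b : ℤ) ∣ n := by simpa [BFreeSet] using hyn.2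
  have hb0 : 0 < b := two_pos.trans_le (hBpos b hb)
  obtain ⟨W, hWF, hW⟩ := exists_finset_residues (BFreeSet B) (Int.natCast_pos.2 hb0)
  obtain ⟨t, ht⟩ := exists_shift_eq_of_mem_Xeta hy (insert n W)
  have hnt : n + t ∈ BFreeSet B :=
    (eta_eq_true_iff B _).1 ((ht n (Finset.mem_insert_self _ _)).trans hyn.1)
  refine hnt b hb (dvd_add hbn (dvd_of_residues_stable hBprim hb hb0 fun x hx => ?_))
  obtain ⟨w, hw, hwx⟩ := hW x hx
  refine ⟨w + t, ?_, by simpa using hwx⟩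
  have hwF := (eta_eq_true_iff B w).2 (hWF hw)
  rw [← eta_eq_true_iff, ht w (Finset.mem_insert_of_mem hw)]
  exact top_le_iff.1 (hwF.ge.trans (hle w))
end

section
/- Assume B is infinite, its elements are pairwise coprime, and 1 ∉ B. Let u be a B-admissible word of length L (a function u : {1,…,L} → {0,1} whose support supp(u) ⊆ {1,…,L} is B-admissible), let N_u = |supp(u)|, and let b₀ ∈ B with b₀ > 2L. Then there exist a B-admissible word w and positions m_1, …, m_{b₀−N_u} such that: (i) w(m_i + j) = u(j) for every j ∈ {1,…,L} and every i; (ii) the set {m_1, …, m_{b₀−N_u}} taken modulo b₀ equals {0,…,b₀−1} ∖ ((−supp(u)) mod b₀); and (iii) supp(w) modulo b₀ equals {1,…,b₀−1}. -/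
open Filter Set

/-- A finite set with fewer than `b` elements misses a residue class modulo `b`. -/
theorem exists_residue_of_card_lt (T : Finset ℤ) (b : ℕ) (h : T.card < b) :
    ∃ r : ℤ, ∀ a ∈ T, ¬ ((b : ℤ) ∣ (a - r)) := by
  classical
  have : NeZero b := ⟨by omega⟩
  obtain ⟨r, hr⟩ : ∃ r : ZMod b, r ∉ T.image (fun n : ℤ => (n : ZMod b)) := by
    by_contra! hall
    have hle := Finset.card_le_card
      (fun r _ => hall r : (Finset.univ : Finset (ZMod b)) ⊆ T.image (fun n : ℤ => (n : ZMod b)))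
    rw [Finset.card_univ, ZMod.card] at hle
    exact absurd (hle.trans Finset.card_image_le) (by omega)
  obtain ⟨r, rfl⟩ := ZMod.intCast_surjective r
  refine ⟨r, fun a ha hdvd => hr (Finset.mem_image.2 ⟨a, ha, ?_⟩)⟩
  rw [← sub_eq_zero, ← Int.cast_sub]
  exact (ZMod.intCast_zmod_eq_zero_iff_dvd _ _).2 hdvd

/-- There is an arbitrarily large integer that is `1` modulo `b₀` and divisible by all other
elements of `B` up to a given bound. -/
theorem exists_large_eq_one_dvd {B : Set ℕ} (hcop : ∀ a ∈ B, ∀ b ∈ B, a ≠ b → Nat.Coprime a b)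
    (hpos : ∀ b ∈ B, 0 < b) {b₀ : ℕ} (hb₀ : b₀ ∈ B) (M K : ℕ) :
    ∃ E : ℤ, (K : ℤ) < E ∧ (E : ZMod b₀) = 1 ∧
      ∀ b ∈ B, b ≤ M → b ≠ b₀ → (b : ℤ) ∣ E := by
  classical
  set I := (Finset.range (M + 1)).filter (fun b => b ∈ B ∧ b ≠ b₀) with hI
  set P := ∏ b ∈ I, b with hP
  have hcopP : Nat.Coprime P b₀ := Nat.Coprime.prod_left fun b hb => by
    simp only [hI, Finset.mem_filter] at hb
    exact hcop b hb.2.1 b₀ hb₀ hb.2.2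
  have hPpos : 0 < P := Finset.prod_pos fun b hb => by
    simp only [hI, Finset.mem_filter] at hb
    exact hpos b hb.2.1
  obtain ⟨s, hs0, hs1⟩ := Nat.chineseRemainder hcopP 0 1
  have hmul : (K + 1) ≤ P * b₀ * (K + 1) := Nat.le_mul_of_pos_left _ (Nat.mul_pos hPpos (hpos b₀ hb₀))
  refine ⟨((s + P * b₀ * (K + 1) : ℕ) : ℤ), by exact_mod_cast (by omega), ?_, ?_⟩
  · have := (ZMod.natCast_eq_natCast_iff _ _ _).2 hs1
    push_cast at this ⊢
    simp [this]
  · intro b hb hbM hne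
    have hbP : b ∣ P := Finset.dvd_prod_of_mem _
      (Finset.mem_filter.2 ⟨Finset.mem_range.2 (by omega), hb, hne⟩)
    refine Int.natCast_dvd_natCast.2 (dvd_add (hbP.trans ?_) ?_)
    · exact Nat.modEq_zero_iff_dvd.1 hs0
    · exact (hbP.mul_right _).mul_right _

/-- A nonempty `A ⊆ [1, L]` contains, and the empty set can be enlarged by, a point of
`[1, L + 1]` without destroying admissibility. -/
theorem exists_isBAdmissible_insert {B : Set ℕ} (hB : ∀ b ∈ B, 2 ≤ b) {A : Set ℤ} {L : ℕ}
    (hA : A ⊆ Set.Icc 1 (L : ℤ)) (hadm : IsBAdmissible B A) :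
    ∃ j₀ : ℤ, 1 ≤ j₀ ∧ j₀ ≤ L + 1 ∧ IsBAdmissible B (insert j₀ A) := by
  rcases A.eq_empty_or_nonempty with rfl | ⟨j, hj⟩
  · refine ⟨1, le_rfl, by omega, fun b hb => ⟨0, fun a ha hdvd => ?_⟩⟩
    obtain rfl : a = 1 := by simpa using ha
    have := Int.le_of_dvd one_pos (by simpa using hdvd)
    have := hB b hb
    omega
  · have := hA hj
    exact ⟨j, this.1, by linarith [this.2], by rwa [Set.insert_eq_of_mem hj]⟩

/-- Base-`E` expansions with digits in `[1, E]` are unique. -/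
theorem eq_of_mul_add_eq {E k k' j j' : ℤ} (hj : 1 ≤ j) (hjE : j ≤ E) (hj' : 1 ≤ j')
    (hjE' : j' ≤ E) (h : k * E + j = k' * E + j') : k = k' ∧ j = j' := by
  have hk : k = k' := by
    rcases lt_trichotomy k k' with hlt | heq | hlt
    · nlinarith
    · exact heq
    · nlinarith
  subst hk
  exact ⟨rfl, by linarith⟩

/-- A set of integers in `[1, L]` with `L < b` has the same number of negated residues
modulo `b`. -/
theorem ncard_neg_residues {A : Set ℤ} {L b : ℕ} (hA : A ⊆ Set.Icc 1 (L : ℤ)) (hL : L < b) :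
    {r : ZMod b | ∃ j ∈ A, r = -(j : ZMod b)}.ncard = A.ncard := by
  have himage : {r : ZMod b | ∃ j ∈ A, r = -(j : ZMod b)} =
      (fun j : ℤ => -(j : ZMod b)) '' A := by
    ext r
    simp [eq_comm]
  rw [himage]
  refine Set.InjOn.ncard_image fun x hx y hy hxy => ?_
  have hmod := (ZMod.intCast_eq_intCast_iff _ _ _).1 (neg_injective hxy)
  have h1 := hA hx
  have h2 := hA hy
  have hlt : (L : ℤ) < b := by exact_mod_cast hL
  have := hmod.eq
  rwa [Int.emod_eq_of_lt (by linarith [h1.1]) (by linarith [h1.2]),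
    Int.emod_eq_of_lt (by linarith [h2.1]) (by linarith [h2.2])] at this

/-- The union of the copies `k * E + A`, where `k < b` avoids `-A` modulo `b`, and of the single
points `k * E + j₀` with `b ≤ k < 2 * b` that are nonzero modulo `b` when `E` is `1`
modulo `b`. -/
def copiesSet (A : Set ℤ) (b : ℕ) (E j₀ : ℤ) : Set ℤ :=
  {n | ∃ (k : ℕ) (j : ℤ), n = k * E + j ∧
    ((k < b ∧ j ∈ A ∧ ∀ i ∈ A, (k : ZMod b) ≠ -(i : ZMod b)) ∨
      (b ≤ k ∧ k < 2 * b ∧ j = j₀ ∧ (k : ZMod b) + (j₀ : ZMod b) ≠ 0))}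

theorem exists_of_mem_copiesSet {A : Set ℤ} {b : ℕ} {E j₀ n : ℤ} (h : n ∈ copiesSet A b E j₀) :
    ∃ (k : ℕ) (j : ℤ), n = k * E + j ∧ k < 2 * b ∧ j ∈ insert j₀ A := by
  obtain ⟨k, j, rfl, ⟨hk, hj, -⟩ | ⟨-, hk, hj, -⟩⟩ := h
  · exact ⟨k, j, rfl, by omega, Or.inr hj⟩
  · exact ⟨k, j, rfl, hk, Or.inl hj⟩

theorem image_copiesSet {A : Set ℤ} {b : ℕ} [NeZero b] {E j₀ : ℤ} (hE : (E : ZMod b) = 1) :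
    (fun n : ℤ => (n : ZMod b)) '' copiesSet A b E j₀ = {(0 : ZMod b)}ᶜ := by
  ext c
  simp only [Set.mem_image, Set.mem_compl_iff, Set.mem_singleton_iff]
  constructor
  · rintro ⟨n, ⟨k, j, rfl, ⟨-, hj, hk⟩ | ⟨-, -, rfl, hk⟩⟩, rfl⟩
    · simpa [hE, ← eq_neg_iff_add_eq_zero] using hk j hj
    · simpa [hE] using hk
  · intro hc
    have hlt := ZMod.val_lt (c - (j₀ : ZMod b))
    refine ⟨((b + (c - (j₀ : ZMod b)).val : ℕ) : ℤ) * E + j₀,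
      ⟨_, _, rfl, Or.inr ⟨by omega, by omega, rfl, ?_⟩⟩, ?_⟩
    · simpa using hc
    · simp [hE]

theorem mem_copiesSet_iff {A : Set ℤ} {b L : ℕ} {E j₀ : ℤ} (hA : A ⊆ Set.Icc 1 (L : ℤ))
    (hj₀ : 1 ≤ j₀) (hj₀L : j₀ ≤ L + 1) (hE : (L : ℤ) < E) {k : ℕ} (hk : k < b)
    (hkA : ∀ i ∈ A, (k : ZMod b) ≠ -(i : ZMod b)) {j : ℤ} (hj : 1 ≤ j) (hjL : j ≤ L) :
    (k : ℤ) * E + j ∈ copiesSet A b E j₀ ↔ j ∈ A := by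
  refine ⟨?_, fun h => ⟨k, j, rfl, Or.inl ⟨hk, h, hkA⟩⟩⟩
  rintro ⟨k', j', heq, ⟨-, hj', -⟩ | ⟨hk', -, rfl, -⟩⟩
  · have := hA hj'
    rwa [(eq_of_mul_add_eq hj (by linarith) this.1 (by linarith [this.2]) heq).2]
  · have := (eq_of_mul_add_eq hj (by linarith) hj₀ (by linarith) heq).1
    omega

theorem copiesSet_subset_Icc {A : Set ℤ} {b L : ℕ} {E j₀ : ℤ} (hA : A ⊆ Set.Icc 1 (L : ℤ))
    (hj₀ : 1 ≤ j₀) (hj₀L : j₀ ≤ L + 1) (hE : 0 ≤ E) :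
    copiesSet A b E j₀ ⊆ Set.Icc 1 (2 * b * E + (L + 1)) := by
  intro n hn
  obtain ⟨k, j, rfl, hk, hj⟩ := exists_of_mem_copiesSet hn
  have hj' : 1 ≤ j ∧ j ≤ L + 1 := by
    rcases hj with rfl | hj
    · exact ⟨hj₀, hj₀L⟩
    · exact ⟨(hA hj).1, by linarith [(hA hj).2]⟩
  have hk' : (k : ℤ) ≤ 2 * b := by exact_mod_cast hk.le
  have h1 : 0 ≤ (k : ℤ) * E := by positivity
  have h2 : (k : ℤ) * E ≤ 2 * b * E := mul_le_mul_of_nonneg_right hk' hE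
  exact ⟨by linarith, by linarith⟩

theorem isBAdmissible_copiesSet {B : Set ℕ} {A : Set ℤ} {b₀ L : ℕ} [NeZero b₀] {E j₀ : ℤ}
    (hA : A ⊆ Set.Icc 1 (L : ℤ)) (hj₀ : 1 ≤ j₀) (hj₀L : j₀ ≤ L + 1)
    (hadm : IsBAdmissible B (insert j₀ A)) (hE : (E : ZMod b₀) = 1)
    (hdvd : ∀ b ∈ B, b ≤ 2 * b₀ * (L + 1) → b ≠ b₀ → (b : ℤ) ∣ E) :
    IsBAdmissible B (copiesSet A b₀ E j₀) := by
  classical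
  intro b hb
  by_cases hbb₀ : b = b₀
  · subst hbb₀
    refine ⟨0, fun a ha h => ?_⟩
    have hmem := Set.mem_image_of_mem (fun n : ℤ => (n : ZMod b)) ha
    rw [image_copiesSet hE] at hmem
    exact hmem ((ZMod.intCast_zmod_eq_zero_iff_dvd _ _).2 (by simpa using h))
  by_cases hle : b ≤ 2 * b₀ * (L + 1)
  · obtain ⟨r, hr⟩ := hadm b hb
    refine ⟨r, fun a ha h => ?_⟩
    obtain ⟨k, j, rfl, -, hj⟩ := exists_of_mem_copiesSet ha
    refine hr j hj ?_
    rw [add_sub_assoc] at h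
    exact (dvd_add_right ((hdvd b hb hle hbb₀).mul_left _)).1 h
  · let T : Finset ℤ := (Finset.range (2 * b₀) ×ˢ Finset.Icc (1 : ℤ) (L + 1)).image
      fun p => (p.1 : ℤ) * E + p.2
    have hT : T.card ≤ 2 * b₀ * (L + 1) := by
      refine Finset.card_image_le.trans_eq ?_
      simp only [Finset.card_product, Finset.card_range, Int.card_Icc]
      congr 1
      omega
    obtain ⟨r, hr⟩ := exists_residue_of_card_lt T b (by omega)
    refine ⟨r, fun a ha => hr a ?_⟩
    obtain ⟨k, j, rfl, hk, hj⟩ := exists_of_mem_copiesSet ha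
    refine Finset.mem_image.2 ⟨(k, j), Finset.mem_product.2 ⟨Finset.mem_range.2 hk, ?_⟩, rfl⟩
    rcases hj with rfl | hj
    · exact Finset.mem_Icc.2 ⟨hj₀, hj₀L⟩
    · exact Finset.mem_Icc.2 ⟨(hA hj).1, by linarith [(hA hj).2]⟩

/-- shifted copies of an admissible word `u` can be arranged into an
admissible word `w`, with prescribed residues of the copy positions mod `b₀`, and with
`supp w` meeting exactly the nonzero residue classes mod `b₀`. -/
theorem shifted_copies_admissible (B : Set ℕ) (hBinf : B.Infinite)
    (hBpos : ∀ b ∈ B, 2 ≤ b)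
    (hBcop : ∀ a ∈ B, ∀ b ∈ B, a ≠ b → Nat.Coprime a b)
    (L : ℕ) (u : ℤ → Bool) (husupp : supp u ⊆ Set.Icc 1 (L : ℤ))
    (hadm : IsBAdmissible B (supp u))
    (b₀ : ℕ) (hb₀ : b₀ ∈ B) (hb₀L : 2 * L < b₀) :
    ∃ (w : ℤ → Bool) (Lw : ℕ), supp w ⊆ Set.Icc 1 (Lw : ℤ) ∧
      IsBAdmissible B (supp w) ∧
      ∃ m : Fin (b₀ - (supp u).ncard) → ℤ,
        (∀ i, ∀ j : ℤ, 1 ≤ j → j ≤ (L : ℤ) → w (m i + j) = u j) ∧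
        Function.Injective (fun i => ((m i : ℤ) : ZMod b₀)) ∧
        Set.range (fun i => ((m i : ℤ) : ZMod b₀)) =
          {r : ZMod b₀ | ∃ j ∈ supp u, r = -((j : ℤ) : ZMod b₀)}ᶜ ∧
        (fun n : ℤ => ((n : ℤ) : ZMod b₀)) '' supp w = {(0 : ZMod b₀)}ᶜ := by
  classical
  have : NeZero b₀ := ⟨by omega⟩
  obtain ⟨j₀, hj₀, hj₀L, hadm'⟩ := exists_isBAdmissible_insert hBpos husupp hadm
  obtain ⟨E, hLE, hE, hdvd⟩ := exists_large_eq_one_dvd hBcop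
    (fun b hb => two_pos.trans_le (hBpos b hb)) hb₀ (2 * b₀ * (L + 1)) L
  have hE0 : 0 ≤ E := by omega
  let w : ℤ → Bool := fun n => decide (n ∈ copiesSet (supp u) b₀ E j₀)
  have hw : supp w = copiesSet (supp u) b₀ E j₀ := by
    ext n
    exact decide_eq_true_iff
  let R : Set (ZMod b₀) := {r : ZMod b₀ | ∃ j ∈ supp u, r = -((j : ℤ) : ZMod b₀)}ᶜ
  have hR : Nat.card R = b₀ - (supp u).ncard := by
    rw [Nat.card_coe_set_eq, Set.ncard_compl, Nat.card_zmod,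
      ncard_neg_residues husupp (by omega)]
  let e : Fin (b₀ - (supp u).ncard) ≃ R := (Finite.equivFinOfCardEq hR).symm
  have hcast : (fun i => ((((e i : ZMod b₀).val : ℤ) * E : ℤ) : ZMod b₀)) =
      fun i => (e i : ZMod b₀) := by
    funext i
    simp [hE]
  refine ⟨w, (2 * b₀ * E + (L + 1)).toNat, ?_, ?_,
    fun i => ((e i : ZMod b₀).val : ℤ) * E, ?_, ?_, ?_, ?_⟩
  · rw [hw, Int.toNat_of_nonneg (by positivity)]
    exact copiesSet_subset_Icc husupp hj₀ hj₀L hE0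
  · rw [hw]
    exact isBAdmissible_copiesSet husupp hj₀ hj₀L hadm' hE hdvd
  · intro i j hj hjL
    have hiff := mem_copiesSet_iff husupp hj₀ hj₀L hLE (ZMod.val_lt (e i : ZMod b₀))
      (fun a ha h => (e i).2 ⟨a, ha, by simpa using h⟩) hj hjL
    rw [Bool.eq_iff_iff]
    exact decide_eq_true_iff.trans hiff
  · rw [hcast]
    exact Subtype.val_injective.comp e.injective
  · rw [hcast]
    exact (e.surjective.range_comp Subtype.val).trans Subtype.range_coe
  · rw [hw]
    exact image_copiesSet hE
end
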